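/- (Coercivity part of Lemma: SBL cost) Assume the nondegeneracy condition: for every i ∈ {1,…,n} there exists k ∈ {1,…,K} such that the (k, i)-th column of the matrix (diag(z) ⊗ A)·D̃ is nonzero. Then L(γ, z) → −∞ as ‖γ‖ → ∞ over the nonnegative orthant; equivalently, γ ↦ −L(γ, z) is coercive on {γ ∈ ℝ^n : γ_i ≥ 0 for all i}. -/

import Mathlib

open Matrix Real Kronecker Filter Topology

/-- The block lower-triangular matrix `D̃ ∈ ℝ^{Kn×Kn}` whose `(k, j)`-th `n×n`
block is `D^{k−j}` for `j ≤ k` and `0` otherwise. -/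
noncomputable def Dtilde {n K : ℕ} (D : Matrix (Fin n) (Fin n) ℝ) :
    Matrix (Fin K × Fin n) (Fin K × Fin n) ℝ :=
  fun p q =>
    if (q.1 : ℕ) ≤ (p.1 : ℕ) then (D ^ ((p.1 : ℕ) - (q.1 : ℕ))) p.2 q.2 else 0

/-- The covariance matrix
`R_Y(γ, z) = (diag z ⊗ A) · D̃ · (I_K ⊗ diag γ) · D̃ᵀ · (diag z ⊗ Aᵀ)`. -/
noncomputable def RY {n m K : ℕ} (A : Matrix (Fin m) (Fin n) ℝ)
    (D : Matrix (Fin n) (Fin n) ℝ) (z : Fin K → ℝ) (γ : Fin n → ℝ) :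
    Matrix (Fin K × Fin m) (Fin K × Fin m) ℝ :=
  ((((Matrix.diagonal z ⊗ₖ A) *
      (Dtilde D : Matrix (Fin K × Fin n) (Fin K × Fin n) ℝ)) *
    ((1 : Matrix (Fin K) (Fin K) ℝ) ⊗ₖ Matrix.diagonal γ)) *
    (Dtilde D : Matrix (Fin K × Fin n) (Fin K × Fin n) ℝ)ᵀ) *
    (Matrix.diagonal z ⊗ₖ Aᵀ)

/-- The SBL cost
`L(γ, z) = -(Km/2)·log(2π) - (1/2)·log det(R_Y(γ,z) + σ²I) - (1/2)·yᵀ(R_Y(γ,z) + σ²I)⁻¹y`. -/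
noncomputable def Lsbl {n m K : ℕ} (A : Matrix (Fin m) (Fin n) ℝ)
    (D : Matrix (Fin n) (Fin n) ℝ) (z : Fin K → ℝ) (y : Fin K × Fin m → ℝ)
    (σ2 : ℝ) (γ : Fin n → ℝ) : ℝ :=
  -(((K * m : ℕ) : ℝ) / 2) * Real.log (2 * π)
    - (1 / 2) * Real.log (RY A D z γ
        + σ2 • (1 : Matrix (Fin K × Fin m) (Fin K × Fin m) ℝ)).det
    - (1 / 2) * (y ⬝ᵥ (RY A D z γ
        + σ2 • (1 : Matrix (Fin K × Fin m) (Fin K × Fin m) ℝ))⁻¹ *ᵥ y)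

theorem Finset.one_add_sum_le_prod_one_add_of_nonneg {ι : Type*} (s : Finset ι) {f : ι → ℝ}
    (hf : ∀ i, 0 ≤ f i) : 1 + ∑ i ∈ s, f i ≤ ∏ i ∈ s, (1 + f i) := by
  classical
  induction s using Finset.induction_on with
  | empty => simp
  | insert a s ha ih =>
    rw [Finset.sum_insert ha, Finset.prod_insert ha]
    nlinarith [hf a, mul_nonneg (hf a) (Finset.sum_nonneg fun i (_ : i ∈ s) => hf i),
      mul_le_mul_of_nonneg_left ih (hf a)]

open Polynomial in
/-- For a positive semidefinite matrix, `1 + tr P ≤ det (1 + P)`. -/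
theorem Matrix.PosSemidef.one_add_trace_le_det_one_add {ι : Type*} [Fintype ι] [DecidableEq ι]
    {P : Matrix ι ι ℝ} (hP : P.PosSemidef) : 1 + P.trace ≤ (1 + P).det := by
  have hdet : (1 + P).det = ∏ i, (1 + hP.isHermitian.eigenvalues i) := by
    have h := congrArg (Polynomial.eval (-1)) hP.isHermitian.charpoly_eq
    rw [Matrix.eval_charpoly, Polynomial.eval_prod] at h
    have hneg : Matrix.scalar ι (-1 : ℝ) - P = -(1 + P) := by
      rw [map_neg, map_one]; abel
    have hfac : ∀ i, Polynomial.eval (-1 : ℝ) (X - C (hP.isHermitian.eigenvalues i)) =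
        -(1 + hP.isHermitian.eigenvalues i) := fun i => by simp; ring
    simp only [RCLike.ofReal_real_eq_id, id_eq] at h
    rw [hneg, Matrix.det_neg, Finset.prod_congr rfl fun i _ => hfac i, Finset.prod_neg,
      Finset.card_univ] at h
    exact mul_left_cancel₀ (pow_ne_zero _ (by norm_num)) h
  have htr : P.trace = ∑ i, hP.isHermitian.eigenvalues i := by
    simpa using hP.isHermitian.trace_eq_sum_eigenvalues
  rw [hdet, htr]
  exact Finset.univ.one_add_sum_le_prod_one_add_of_nonneg hP.eigenvalues_nonneg

theorem Matrix.PosSemidef.trace_le_det_add_smul_one {ι : Type*} [Fintype ι] [DecidableEq ι]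
    {R : Matrix ι ι ℝ} (hR : R.PosSemidef) {s : ℝ} (hs : 0 < s) :
    s ^ Fintype.card ι * (1 + s⁻¹ * R.trace) ≤ (R + s • (1 : Matrix ι ι ℝ)).det := by
  have hfac : R + s • (1 : Matrix ι ι ℝ) = s • (1 + s⁻¹ • R) := by
    rw [smul_add, smul_smul, mul_inv_cancel₀ hs.ne', one_smul, add_comm]
  have h := (hR.smul (inv_nonneg.2 hs.le)).one_add_trace_le_det_one_add
  rw [Matrix.trace_smul, smul_eq_mul] at h
  rw [hfac, Matrix.det_smul]
  gcongr

theorem EuclideanSpace.norm_le_sum_of_nonneg {ι : Type*} [Fintype ι] (x : EuclideanSpace ℝ ι)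
    (hx : ∀ i, 0 ≤ x i) : ‖x‖ ≤ ∑ i, x i := by
  refine le_of_abs_le <| abs_le_of_sq_le_sq ?_ (Finset.sum_nonneg fun i _ => hx i)
  rw [EuclideanSpace.real_norm_sq_eq]
  exact Finset.sum_sq_le_sq_sum_of_nonneg fun i _ => hx i

/-- The matrix `(diag z ⊗ A) · D̃` that maps the stacked innovations to the observations. -/
noncomputable def sensingMatrix {n m K : ℕ} (A : Matrix (Fin m) (Fin n) ℝ)
    (D : Matrix (Fin n) (Fin n) ℝ) (z : Fin K → ℝ) :
    Matrix (Fin K × Fin m) (Fin K × Fin n) ℝ :=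
  (Matrix.diagonal z ⊗ₖ A) * (Dtilde D : Matrix (Fin K × Fin n) (Fin K × Fin n) ℝ)

theorem RY_eq_mul_diagonal_mul_transpose {n m K : ℕ} (A : Matrix (Fin m) (Fin n) ℝ)
    (D : Matrix (Fin n) (Fin n) ℝ) (z : Fin K → ℝ) (γ : Fin n → ℝ) :
    RY A D z γ = sensingMatrix A D z *
      Matrix.diagonal (fun p : Fin K × Fin n => γ p.2) * (sensingMatrix A D z)ᵀ := by
  have h : (1 : Matrix (Fin K) (Fin K) ℝ) ⊗ₖ Matrix.diagonal γ =
      Matrix.diagonal (fun p : Fin K × Fin n => γ p.2) := by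
    rw [← Matrix.diagonal_one, Matrix.diagonal_kronecker_diagonal]
    simp
  rw [RY, sensingMatrix, h, Matrix.transpose_mul, ← Matrix.kroneckerMap_transpose,
    Matrix.diagonal_transpose, ← Matrix.mul_assoc]

theorem RY_posSemidef {n m K : ℕ} (A : Matrix (Fin m) (Fin n) ℝ)
    (D : Matrix (Fin n) (Fin n) ℝ) (z : Fin K → ℝ) {γ : Fin n → ℝ} (hγ : ∀ i, 0 ≤ γ i) :
    (RY A D z γ).PosSemidef := by
  rw [RY_eq_mul_diagonal_mul_transpose, ← Matrix.conjTranspose_eq_transpose_of_trivial]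
  exact (Matrix.PosSemidef.diagonal fun p : Fin K × Fin n => hγ p.2).mul_mul_conjTranspose_same _

theorem trace_RY {n m K : ℕ} (A : Matrix (Fin m) (Fin n) ℝ)
    (D : Matrix (Fin n) (Fin n) ℝ) (z : Fin K → ℝ) (γ : Fin n → ℝ) :
    (RY A D z γ).trace =
      ∑ i, (∑ k, ∑ r, sensingMatrix A D z r (k, i) ^ 2) * γ i := by
  rw [RY_eq_mul_diagonal_mul_transpose]
  simp only [Matrix.trace, Matrix.diag_apply, Matrix.mul_apply (N := (sensingMatrix A D z)ᵀ),
    Matrix.mul_diagonal, Matrix.transpose_apply]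
  rw [Finset.sum_comm, Fintype.sum_prod_type_right]
  refine Finset.sum_congr rfl fun i _ => ?_
  rw [Finset.sum_mul]
  refine Finset.sum_congr rfl fun k _ => ?_
  rw [Finset.sum_mul]
  exact Finset.sum_congr rfl fun r _ => by ring

theorem exists_pos_mul_norm_le_trace_RY {n m K : ℕ} (hn : 0 < n)
    (A : Matrix (Fin m) (Fin n) ℝ) (D : Matrix (Fin n) (Fin n) ℝ) (z : Fin K → ℝ)
    (hnondeg : ∀ i : Fin n, ∃ k : Fin K,
      (fun r : Fin K × Fin m => sensingMatrix A D z r (k, i)) ≠ 0) :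
    ∃ c : ℝ, 0 < c ∧ ∀ γ : EuclideanSpace ℝ (Fin n), (∀ i, 0 ≤ γ i) →
      c * ‖γ‖ ≤ (RY A D z (fun i => γ i)).trace := by
  have : Nonempty (Fin n) := ⟨⟨0, hn⟩⟩
  obtain ⟨i₀, hi₀⟩ := Finite.exists_min fun i : Fin n =>
    ∑ k : Fin K, ∑ r, sensingMatrix A D z r (k, i) ^ 2
  refine ⟨∑ k : Fin K, ∑ r, sensingMatrix A D z r (k, i₀) ^ 2, ?_, fun γ hγ => ?_⟩
  · obtain ⟨k, hk⟩ := hnondeg i₀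
    obtain ⟨r, hr⟩ := Function.ne_iff.1 hk
    refine Finset.sum_pos' (fun k _ => Finset.sum_nonneg fun r _ => sq_nonneg _)
      ⟨k, Finset.mem_univ k, Finset.sum_pos' (fun r _ => sq_nonneg _)
        ⟨r, Finset.mem_univ r, ?_⟩⟩
    exact sq_pos_iff.2 hr
  · rw [trace_RY]
    refine (mul_le_mul_of_nonneg_left (EuclideanSpace.norm_le_sum_of_nonneg γ hγ)
      (Finset.sum_nonneg fun k _ => Finset.sum_nonneg fun r _ => sq_nonneg _)).trans ?_
    rw [Finset.mul_sum]
    exact Finset.sum_le_sum fun i _ => mul_le_mul_of_nonneg_right (hi₀ i) (hγ i)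

/-- coercivity part of the SBL-cost lemma: under the nondegeneracy
condition that for every `i` some column `(k, i)` of `(diag z ⊗ A)·D̃` is nonzero,
`L(γ, z) → −∞` as the Euclidean norm `‖γ‖ → ∞` over the nonnegative orthant
(equivalently, `γ ↦ −L(γ, z)` is coercive there). -/
theorem Lsbl_coercive {n m K : ℕ} (hn : 0 < n) (hm : 0 < m) (hK : 0 < K)
    (A : Matrix (Fin m) (Fin n) ℝ) (D : Matrix (Fin n) (Fin n) ℝ)
    (z : Fin K → ℝ) (hz : ∀ k, z k = 0 ∨ z k = 1)
    (y : Fin K × Fin m → ℝ) (σ2 : ℝ) (hσ2 : 0 < σ2)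
    (hnondeg : ∀ i : Fin n, ∃ k : Fin K,
      (fun r : Fin K × Fin m =>
        ((Matrix.diagonal z ⊗ₖ A) *
          (Dtilde D : Matrix (Fin K × Fin n) (Fin K × Fin n) ℝ)) r (k, i)) ≠ 0) :
    Tendsto
      (fun γ : EuclideanSpace ℝ (Fin n) => Lsbl A D z y σ2 (fun i => γ i))
      ((Filter.comap (fun γ : EuclideanSpace ℝ (Fin n) => ‖γ‖) atTop) ⊓
        Filter.principal {γ : EuclideanSpace ℝ (Fin n) | ∀ i, 0 ≤ γ i})
      atBot := by
  obtain ⟨c, hc, htrace⟩ := exists_pos_mul_norm_le_trace_RY hn A D z hnondeg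
  set N := Fintype.card (Fin K × Fin m)
  have hlower : Tendsto (fun t : ℝ => Real.log (σ2 ^ N * (1 + σ2⁻¹ * (c * t)))) atTop atTop := by
    refine Real.tendsto_log_atTop.comp (Tendsto.const_mul_atTop (pow_pos hσ2 N) ?_)
    exact tendsto_atTop_add_const_left _ _ ((tendsto_id.const_mul_atTop hc).const_mul_atTop
      (inv_pos.2 hσ2))
  have hupper : Tendsto (fun t : ℝ => -(((K * m : ℕ) : ℝ) / 2) * Real.log (2 * π)
      - (1 / 2) * Real.log (σ2 ^ N * (1 + σ2⁻¹ * (c * t)))) atTop atBot := by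
    simp only [sub_eq_add_neg]
    exact tendsto_atBot_add_const_left _ _
      (tendsto_neg_atTop_atBot.comp (hlower.const_mul_atTop one_half_pos))
  refine tendsto_atBot_mono' _ ?_ (hupper.comp (tendsto_comap.mono_left inf_le_left))
  filter_upwards [mem_inf_of_right (mem_principal_self _)] with γ hγ
  have hγ' : ∀ i, 0 ≤ γ i := hγ
  have hR := RY_posSemidef A D z hγ'
  have hquad : 0 ≤ y ⬝ᵥ (RY A D z (fun i => γ i)
      + σ2 • (1 : Matrix (Fin K × Fin m) (Fin K × Fin m) ℝ))⁻¹ *ᵥ y := by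
    simpa using (hR.add (Matrix.PosSemidef.one.smul hσ2.le)).inv.dotProduct_mulVec_nonneg y
  have hlog : Real.log (σ2 ^ N * (1 + σ2⁻¹ * (c * ‖γ‖))) ≤
      Real.log (RY A D z (fun i => γ i)
        + σ2 • (1 : Matrix (Fin K × Fin m) (Fin K × Fin m) ℝ)).det := by
    refine Real.log_le_log (by positivity) (le_trans ?_ (hR.trace_le_det_add_smul_one hσ2))
    have := htrace γ hγ'
    gcongr
  simp only [Lsbl, Function.comp_apply]
  linarith
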